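/- An irreducible plane curve of degree d ≥ 1 that is smooth (as a projective plane curve) has genus (d−1)(d−2)/2. -/

import Mathlib

open MvPolynomial

namespace MvPolynomial

theorem finrank_homogeneousSubmodule (σ R : Type*) [Fintype σ] [CommRing R] [Nontrivial R]
    (n : ℕ) :
    Module.finrank R (homogeneousSubmodule σ R n) = (Fintype.card σ).multichoose n := by
  classical
  have hs : {m : σ →₀ ℕ | m.degree = n} = ↑((Finset.univ : Finset σ).finsuppAntidiag n) := by
    ext m
    simp [Finset.mem_finsuppAntidiag, Finsupp.degree_eq_sum]
  rw [homogeneousSubmodule_eq_finsupp_supported]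
  refine (Module.finrank_eq_nat_card_basis (basisRestrictSupport R _)).trans ?_
  rw [hs, Nat.card_coe_set_eq, Set.ncard_coe_finset,
    Finset.card_finsuppAntidiag_nat_eq_multichoose, Finset.card_univ]

theorem IsHomogeneous.homogeneousSubmodule_inf_span_singleton {σ R : Type*} [CommRing R]
    {d n : ℕ} (hdn : d ≤ n) {f : MvPolynomial σ R} (hf : f.IsHomogeneous d) :
    homogeneousSubmodule σ R n ⊓ (Ideal.span {f}).restrictScalars R =
      (homogeneousSubmodule σ R (n - d)).map (LinearMap.mulLeft R f) := by
  let : GradedAlgebra (homogeneousSubmodule σ R) := gradedAlgebra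
  ext p
  simp only [Submodule.mem_inf, Submodule.restrictScalars_mem, Ideal.mem_span_singleton,
    Submodule.mem_map, LinearMap.mulLeft_apply]
  constructor
  · rintro ⟨hp, q, rfl⟩
    refine ⟨_, (DirectSum.decompose (homogeneousSubmodule σ R) q (n - d)).2, ?_⟩
    rw [← DirectSum.coe_decompose_mul_of_left_mem_of_le (homogeneousSubmodule σ R) hf hdn,
      DirectSum.decompose_of_mem_same _ hp]
  · rintro ⟨q, hq, rfl⟩
    refine ⟨?_, q, rfl⟩
    simpa [Nat.add_sub_cancel' hdn] using hf.mul hq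

/-- The Hilbert function of a hypersurface. -/
theorem IsHomogeneous.finrank_quotient_add_multichoose {σ k : Type*} [Fintype σ] [Field k]
    {d n : ℕ} (hdn : d ≤ n) {f : MvPolynomial σ k} (hf : f.IsHomogeneous d) (hf0 : f ≠ 0) :
    Module.finrank k ((homogeneousSubmodule σ k n).map
        (Ideal.Quotient.mkₐ k (Ideal.span {f})).toLinearMap) +
      (Fintype.card σ).multichoose (n - d) = (Fintype.card σ).multichoose n := by
  set φ := (Ideal.Quotient.mkₐ k (Ideal.span {f})).toLinearMap with hφ
  have : Module.Finite k (homogeneousSubmodule σ k n) :=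
    Module.Finite.iff_fg.mpr (homogeneousSubmodule_fg σ k n)
  have hker : φ.ker = (Ideal.span {f}).restrictScalars k := by
    ext p
    simp [hφ, Ideal.Quotient.eq_zero_iff_mem]
  have hinj : Function.Injective (LinearMap.mulLeft k f) := mul_right_injective₀ hf0
  have h := (φ.domRestrict (homogeneousSubmodule σ k n)).finrank_range_add_finrank_ker
  rwa [LinearMap.range_domRestrict, LinearMap.ker_domRestrict,
    ← Submodule.finrank_map_subtype_eq, Submodule.map_comap_subtype, hker,
    hf.homogeneousSubmodule_inf_span_singleton hdn,
    ← (Submodule.equivMapOfInjective _ hinj _).finrank_eq,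
    finrank_homogeneousSubmodule, finrank_homogeneousSubmodule] at h

end MvPolynomial

theorem Nat.two_mul_three_multichoose (n : ℕ) :
    2 * Nat.multichoose 3 n = (n + 2) * (n + 1) := by
  rw [Nat.multichoose_eq, show 3 + n - 1 = n + 2 by omega, Nat.choose_symm_add,
    Nat.choose_two_right, Nat.mul_div_cancel' (Nat.even_mul_pred_self _).two_dvd]
  rfl

/-- Genus–degree formula: a smooth irreducible plane projective curve `C ⊂ ℙ²` of degree `d ≥ 1`
over an algebraically closed field of characteristic zero has genus `(d-1)(d-2)/2`. The genus is
characterized via the Hilbert function of the homogeneous coordinate ring: for `n` large, the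
dimension of the degree-`n` graded piece of `k[X,Y,Z]/(f)` equals `d·n + 1 - g`. -/
theorem genus_degree_formula (k : Type*) [Field k] [IsAlgClosed k] [CharZero k]
    (d : ℕ) (hd : 1 ≤ d) (f : MvPolynomial (Fin 3) k) (hf : f.IsHomogeneous d)
    (hirr : Irreducible f)
    (hsmooth : ∀ p : Fin 3 → k, p ≠ 0 →
      (∀ i : Fin 3, MvPolynomial.eval p (MvPolynomial.pderiv i f) = 0) → False) :
    ∃ g : ℕ, g = (d - 1) * (d - 2) / 2 ∧ ∀ n : ℕ, d ≤ n →
      (Module.finrank k ((MvPolynomial.homogeneousSubmodule (Fin 3) k n).map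
        (Ideal.Quotient.mkₐ k (Ideal.span {f})).toLinearMap) : ℤ) = d * n + 1 - g := by
  refine ⟨_, rfl, fun n hn => ?_⟩
  have h := hf.finrank_quotient_add_multichoose hn hirr.ne_zero
  rw [Fintype.card_fin] at h
  obtain ⟨m, rfl⟩ := Nat.exists_eq_add_of_le hn
  obtain ⟨e, rfl⟩ := Nat.exists_eq_add_of_le' hd
  have hg : 2 * ((e + 1 - 1) * (e + 1 - 2) / 2) = e * (e - 1) :=
    Nat.mul_div_cancel' (Nat.even_mul_pred_self e).two_dvd
  have he : e * (e - 1) + e = e * e := by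
    cases e <;> simp [Nat.mul_succ]
  generalize (e + 1 - 1) * (e + 1 - 2) / 2 = g at hg ⊢
  have h₁ := Nat.two_mul_three_multichoose m
  have h₂ := Nat.two_mul_three_multichoose (e + 1 + m)
  rw [Nat.add_sub_cancel_left] at h
  rw [← hg] at he
  zify at h he h₁ h₂
  push_cast
  linarith
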